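/- Let π be an m-AP-partition of Z_n that contains at least one singleton block and at least one non-singleton block. For each head h of π, let h* denote the nearest non-singleton head of π in the counterclockwise direction from h, and let g(h) be the number of singletons of π lying on the directed path from h* to h, not counting h itself. Then every head h of π at which g attains its maximum over all heads of π is the head of a non-singleton block. More precisely, if s is a singleton of π and h is the first non-singleton head encountered clockwise after s (so that all heads strictly between s and h are singletons), then g(h) > g(s). -/

import Mathlib

/-- The underlying set of the `m`-AP-block of `ZMod n` with head `b.1` and length `b.2`,
namely `{b.1, b.1 + m, b.1 + 2m, …, b.1 + (b.2 - 1)m}` modulo `n`. -/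
def blockSet (n m : ℕ) (b : ZMod n × ℕ) : Finset (ZMod n) :=
  (Finset.range b.2).image fun j => b.1 + ((j * m : ℕ) : ZMod n)

/-- `π` is an `m`-AP-partition of `ZMod n`: a set of `m`-AP-blocks (each recorded by its
head and its length, which must be positive) whose underlying sets form a partition of
`ZMod n`. -/
def IsAPPartition (n m : ℕ) (π : Finset (ZMod n × ℕ)) : Prop :=
  (∀ b ∈ π, 1 ≤ b.2) ∧
  (∀ b₁ ∈ π, ∀ b₂ ∈ π, b₁ ≠ b₂ → Disjoint (blockSet n m b₁) (blockSet n m b₂)) ∧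
  (∀ z : ZMod n, ∃ b ∈ π, z ∈ blockSet n m b)


/-- The heads of the blocks of `π`. -/
def headsOf (n : ℕ) (π : Finset (ZMod n × ℕ)) : Finset (ZMod n) :=
  π.image Prod.fst

/-- The singletons of `π`, i.e. the heads of its blocks of length one. -/
def singles (n : ℕ) (π : Finset (ZMod n × ℕ)) : Finset (ZMod n) :=
  (π.filter fun b => b.2 = 1).image Prod.fst

/-- The non-singleton heads of `π`, i.e. the heads of its blocks of length at least two. -/
def bigHeads (n : ℕ) (π : Finset (ZMod n × ℕ)) : Finset (ZMod n) :=
  (π.filter fun b => 2 ≤ b.2).image Prod.fst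

/-- `gval n π h` is the number of singletons of `π` lying on the directed (clockwise) path
from `h*` to `h`, not counting `h` itself, where `h*` is the nearest non-singleton head of
`π` in the counterclockwise direction from `h`.  Equivalently, it is the number of
singletons `s ≠ h` that are strictly closer behind `h` (the counterclockwise distance
being `(h - s).val`) than every non-singleton head other than `h`. -/
def gval (n : ℕ) (π : Finset (ZMod n × ℕ)) (h : ZMod n) : ℕ :=
  ((singles n π).filter fun s => s ≠ h ∧
    ∀ u ∈ bigHeads n π, u ≠ h → (h - s).val < (h - u).val).card

theorem aux_disj {n m : ℕ} {π : Finset (ZMod n × ℕ)} (hπ : IsAPPartition n m π)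
    {s h : ZMod n} (hs : s ∈ singles n π) (hh : h ∈ bigHeads n π) : s ≠ h := by
  rintro rfl
  simp only [singles, bigHeads, Finset.mem_image, Finset.mem_filter] at hs hh
  obtain ⟨⟨x, k⟩, ⟨h1, h2⟩, h3⟩ := hs
  obtain ⟨⟨y, l⟩, ⟨h4, h5⟩, h6⟩ := hh
  simp only at h2 h3 h5 h6
  subst h3 h6
  have hd := hπ.2.1 _ h1 _ h4 (by intro h; simp only [Prod.mk.injEq] at h; omega)
  rw [Finset.disjoint_left] at hd
  apply hd (a := y)
  · simp only [blockSet, Finset.mem_image, Finset.mem_range]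
    exact ⟨0, by omega, by simp⟩
  · simp only [blockSet, Finset.mem_image, Finset.mem_range]
    exact ⟨0, by omega, by simp⟩

theorem aux_val {n : ℕ} [NeZero n] {a b : ZMod n} (hab : a ≠ b) :
    (a - b).val + (b - a).val = n := by
  have : NeZero (a - b) := ⟨sub_ne_zero.mpr hab⟩
  have h := ZMod.val_neg_of_ne_zero (a - b)
  rw [neg_sub] at h
  have := ZMod.val_lt (a - b)
  omega

theorem aux_mem {α : Type*} {p : α → Prop} {inst : DecidablePred p} {s : Finset α} {a : α} :
    a ∈ @Finset.filter α p inst s ↔ a ∈ s ∧ p a := Finset.mem_filter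

theorem aux_main {n m : ℕ} (hn : 1 ≤ n) {π : Finset (ZMod n × ℕ)}
    (hπ : IsAPPartition n m π) :
    ∀ s ∈ singles n π, ∀ h ∈ bigHeads n π,
      (∀ u ∈ bigHeads n π, (h - s).val ≤ (u - s).val) → gval n π s < gval n π h := by
  intro s hs h hh hmin
  have : NeZero n := ⟨by omega⟩
  have hsh := aux_disj hπ hs hh
  have e1 := aux_val hsh
  have key : ∀ u ∈ bigHeads n π, u ≠ h → (h - u).val = (h - s).val + (s - u).val := by
    intro u hu huh
    have hsu := aux_disj hπ hs hu
    have e2 := aux_val hsu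
    have h1 := hmin u hu
    have h2 : (h - s).val ≠ (u - s).val := fun e =>
      huh (sub_left_injective (ZMod.val_injective n e)).symm
    rw [← ZMod.val_add_of_lt (by omega)]
    congr 1
    ring
  apply Finset.card_lt_card
  rw [Finset.ssubset_iff_of_subset]
  · refine ⟨s, ?_, by simp⟩
    rw [aux_mem]
    refine ⟨hs, hsh, fun u hu huh => ?_⟩
    rw [key u hu huh]
    have h3 : (s - u).val ≠ 0 := by
      rw [Ne, ZMod.val_eq_zero, sub_eq_zero]
      exact aux_disj hπ hs hu
    omega
  · intro t ht
    rw [aux_mem] at ht ⊢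
    obtain ⟨ht1, hts, ht2⟩ := ht
    refine ⟨ht1, aux_disj hπ ht1 hh, fun u hu huh => ?_⟩
    rw [key u hu huh]
    have h4 := ht2 h hh hsh.symm
    have h5 := ht2 u hu (aux_disj hπ hs hu).symm
    have h6 : (h - t).val = (h - s).val + (s - t).val := by
      rw [← ZMod.val_add_of_lt (by omega)]
      congr 1
      ring
    omega

/-- Let `π` be an `m`-AP-partition of `ZMod n` with at least one singleton block and at
least one non-singleton block.  Then every head of `π` at which `g` attains its maximum
over all heads is a non-singleton head; more precisely, if `s` is a singleton of `π` and
`h` is the first non-singleton head encountered clockwise after `s` (i.e. `h` minimizes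
the clockwise distance `(u - s).val` among all non-singleton heads `u`), then
`g h > g s`. -/
theorem statement9 (n m : ℕ) (hn : 1 ≤ n) (hm : 1 ≤ m) (π : Finset (ZMod n × ℕ))
    (hπ : IsAPPartition n m π)
    (hs : (singles n π).Nonempty) (hb : (bigHeads n π).Nonempty) :
    (∀ h ∈ headsOf n π,
      (∀ h' ∈ headsOf n π, gval n π h' ≤ gval n π h) → h ∈ bigHeads n π) ∧
    (∀ s ∈ singles n π, ∀ h ∈ bigHeads n π,
      (∀ u ∈ bigHeads n π, (h - s).val ≤ (u - s).val) → gval n π s < gval n π h) := by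
  refine ⟨?_, aux_main hn hπ⟩
  intro h hh hmax
  by_contra hnot
  obtain ⟨b, hbπ, rfl⟩ := Finset.mem_image.mp hh
  have h1 := hπ.1 b hbπ
  have hsing : b.1 ∈ singles n π := by
    refine Finset.mem_image.mpr ⟨b, Finset.mem_filter.mpr ⟨hbπ, ?_⟩, rfl⟩
    by_contra h2
    exact hnot (Finset.mem_image.mpr ⟨b, Finset.mem_filter.mpr ⟨hbπ, by omega⟩, rfl⟩)
  obtain ⟨v, hv, hvmin⟩ := Finset.exists_min_image (bigHeads n π) (fun u => (u - b.1).val) hb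
  have h3 := aux_main hn hπ b.1 hsing v hv hvmin
  obtain ⟨c, hc, hcv⟩ := Finset.mem_image.mp hv
  have h4 := hmax v (Finset.mem_image.mpr ⟨c, (Finset.mem_filter.mp hc).1, hcv⟩)
  omega
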